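/- There exists a selfdecomposable Borel probability measure μ on ℝ whose characteristic function is t ↦ (cosh t)^{−1/2} · exp(−(1/2) t tanh t). -/

import Mathlib

open MeasureTheory Set

/-- A Borel probability measure `μ` on `ℝ` is selfdecomposable if for every `c ∈ (0,1)`
there is a probability measure `ν` with `μ = (T_c μ) ∗ ν`. -/
def SelfDecomposable (μ : Measure ℝ) : Prop :=
  ∀ c : ℝ, c ∈ Ioo (0 : ℝ) 1 →
    ∃ ν : Measure ℝ, IsProbabilityMeasure ν ∧
      μ = MeasureTheory.Measure.conv (μ.map (fun x => c * x)) ν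

open Filter Topology ProbabilityTheory

lemma integrable_exp_mul_I (ν : Measure ℝ) [IsProbabilityMeasure ν] (t : ℝ) :
    Integrable (fun x : ℝ => Complex.exp (t * x * Complex.I)) ν := by
  refine Integrable.of_bound (by fun_prop) 1 (ae_of_all _ fun x => ?_)
  rw [← Complex.ofReal_mul, Complex.norm_exp_ofReal_mul_I]

/-- The real function `f` is the characteristic function of a probability measure on `ℝ`. -/
def IsCharFun (f : ℝ → ℝ) : Prop :=
  ∃ μ : Measure ℝ, IsProbabilityMeasure μ ∧ ∀ t, charFun μ t = f t

namespace IsCharFun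

variable {f g : ℝ → ℝ}

lemma continuous (hf : IsCharFun f) : Continuous f := by
  obtain ⟨μ, hμ, h⟩ := hf
  have h1 : f = fun t => (charFun μ t).re := by ext t; simp [h]
  rw [h1]
  exact Complex.continuous_re.comp (by fun_prop)

lemma one : IsCharFun fun _ => 1 :=
  ⟨Measure.dirac 0, inferInstance, fun t => by simp [charFun_dirac]⟩

lemma mul (hf : IsCharFun f) (hg : IsCharFun g) : IsCharFun fun t => f t * g t := by
  obtain ⟨μ, hμ, h⟩ := hf
  obtain ⟨ν, hν, h'⟩ := hg
  exact ⟨μ.conv ν, inferInstance, fun t => by rw [charFun_conv, h, h']; push_cast; rfl⟩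

lemma pow (hf : IsCharFun f) (n : ℕ) : IsCharFun fun t => f t ^ n := by
  induction n with
  | zero => simpa using one
  | succ n ih => simpa only [pow_succ] using ih.mul hf

lemma prod {ι : Type*} (s : Finset ι) {F : ι → ℝ → ℝ} (hF : ∀ i, IsCharFun (F i)) :
    IsCharFun fun t => ∏ i ∈ s, F i t := by
  classical
  induction s using Finset.induction_on with
  | empty => simpa using one
  | insert i s hi ih => simpa only [Finset.prod_insert hi] using (hF i).mul ih

lemma comp_mul_left (hf : IsCharFun f) (c : ℝ) : IsCharFun fun t => f (c * t) := by
  obtain ⟨μ, hμ, h⟩ := hf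
  exact ⟨μ.map (c * ·), Measure.isProbabilityMeasure_map (by fun_prop),
    fun t => by rw [charFun_map_mul, h]⟩

/-- The real part of a characteristic function is the characteristic function of the
symmetrized measure. -/
lemma re (μ : Measure ℝ) [IsProbabilityMeasure μ] : IsCharFun fun t => (charFun μ t).re := by
  have hneg : IsProbabilityMeasure (μ.map ((-1 : ℝ) * ·)) :=
    Measure.isProbabilityMeasure_map (by fun_prop)
  refine ⟨(2⁻¹ : ENNReal) • μ + (2⁻¹ : ENNReal) • μ.map ((-1 : ℝ) * ·),
    ⟨by rw [Measure.add_apply, Measure.smul_apply, Measure.smul_apply, hneg.measure_univ,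
      measure_univ, smul_eq_mul, mul_one, ENNReal.inv_two_add_inv_two]⟩, fun t => ?_⟩
  have h2 := charFun_map_mul (μ := μ) (-1) t
  rw [charFun_apply_real] at h2 ⊢
  rw [integral_add_measure ((integrable_exp_mul_I _ t).smul_measure (by simp))
    ((integrable_exp_mul_I _ t).smul_measure (by simp)), integral_smul_measure, integral_smul_measure, h2,
    ← charFun_apply_real, neg_one_mul, charFun_neg]
  apply Complex.ext <;> simp
  ring

/-- Convex combination of a characteristic function with the constant function `1`. -/
lemma convex_one (hf : IsCharFun f) {p : ℝ} (hp0 : 0 ≤ p) (hp1 : p ≤ 1) :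
    IsCharFun fun t => 1 + p * (f t - 1) := by
  obtain ⟨μ, hμ, h⟩ := hf
  refine ⟨ENNReal.ofReal p • μ + ENNReal.ofReal (1 - p) • Measure.dirac 0,
    ⟨by simp [← ENNReal.ofReal_add hp0 (sub_nonneg.2 hp1)]⟩, fun t => ?_⟩
  rw [charFun_apply_real, integral_add_measure ((integrable_exp_mul_I _ t).smul_measure (by simp))
    ((integrable_exp_mul_I _ t).smul_measure (by simp)), integral_smul_measure, integral_smul_measure,
    ← charFun_apply_real, h, ENNReal.toReal_ofReal hp0,
    ENNReal.toReal_ofReal (sub_nonneg.2 hp1)]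
  simp
  ring

/-- **Lévy's continuity theorem**: a pointwise limit of characteristic functions which is
continuous at `0` is a characteristic function. -/
lemma of_tendsto {F : ℕ → ℝ → ℝ} (hF : ∀ᶠ n in atTop, IsCharFun (F n)) (hf : ContinuousAt f 0)
    (h : ∀ t, Tendsto (fun n => F n t) atTop (𝓝 (f t))) : IsCharFun f := by
  obtain ⟨N, hN⟩ := eventually_atTop.1 hF
  choose μ hμ hμF using fun n => hN (n + N) (Nat.le_add_left N n)
  have hlim t : Tendsto (fun n => charFun (μ n) t) atTop (𝓝 (f t : ℂ)) := by
    simp_rw [hμF]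
    exact (Complex.continuous_ofReal.tendsto _).comp ((tendsto_add_atTop_iff_nat N).2 (h t))
  have htight : IsTightMeasureSet (Set.range μ) :=
    isTightMeasureSet_of_tendsto_charFun (f := fun t => (f t : ℂ))
      (Complex.continuous_ofReal.continuousAt.comp hf) hlim
  let ν : ℕ → ProbabilityMeasure ℝ := fun n => ⟨μ n, hμ n⟩
  have hcomp : IsCompact (closure (Set.range ν)) := by
    apply isCompact_closure_of_isTightMeasureSet
    convert htight using 1
    ext m
    constructor
    · rintro ⟨_, ⟨n, rfl⟩, rfl⟩
      exact ⟨n, rfl⟩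
    · rintro ⟨n, rfl⟩
      exact ⟨ν n, ⟨n, rfl⟩, rfl⟩
  obtain ⟨m, -, hm⟩ := hcomp.exists_mapClusterPt (f := atTop) (u := ν)
    (tendsto_principal.2 (Eventually.of_forall fun n => subset_closure ⟨n, rfl⟩))
  refine ⟨m, inferInstance, fun t => ?_⟩
  have hcont : ContinuousAt (fun m : ProbabilityMeasure ℝ => charFun (m : Measure ℝ) t) m := by
    simp_rw [charFun_eq_integral_innerProbChar]
    exact ProbabilityMeasure.tendsto_iff_forall_integral_rclike_tendsto ℂ |>.1 tendsto_id _
  have hclus := hm.tendsto_comp hcont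
  have hlim' : Tendsto ((fun m : ProbabilityMeasure ℝ => charFun (m : Measure ℝ) t) ∘ ν) atTop
    (𝓝 (f t : ℂ)) := hlim t
  exact eq_of_nhds_neBot (hclus.clusterPt.mono hlim')

/-- Compound Poisson distributions. -/
lemma exp_sub_one (hf : IsCharFun f) {w : ℝ} (hw : 0 ≤ w) :
    IsCharFun fun t => Real.exp (w * (f t - 1)) := by
  refine of_tendsto (F := fun n t => (1 + w / n * (f t - 1)) ^ n) ?_ ?_ fun t => ?_
  · filter_upwards [eventually_ge_atTop (⌈w⌉₊ + 1)] with n hn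
    have hn' : w ≤ n := (Nat.le_ceil w).trans (by exact_mod_cast (Nat.le_succ _).trans hn)
    have hn0 : (0 : ℝ) < n := by exact_mod_cast (Nat.succ_pos _).trans_le hn
    exact (hf.convex_one (by positivity) ((div_le_one hn0).2 hn')).pow n
  · have := hf.continuous
    fun_prop
  · simpa only [div_mul_eq_mul_div] using Real.tendsto_one_add_div_pow_exp (w * (f t - 1))

/-- Random rescaling of a distribution. -/
lemma scale_mixture (hf : IsCharFun f) {X : Type*} [MeasurableSpace X] (P : Measure X)
    [IsProbabilityMeasure P] {s : X → ℝ} (hs : Measurable s) :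
    IsCharFun fun t => ∫ r, f (s r * t) ∂P := by
  obtain ⟨μ, hμ, h⟩ := hf
  have hm : Measurable fun p : X × ℝ => s p.1 * p.2 := by fun_prop
  refine ⟨(P.prod μ).map fun p => s p.1 * p.2,
    Measure.isProbabilityMeasure_map hm.aemeasurable, fun t => ?_⟩
  rw [charFun_apply_real, integral_map hm.aemeasurable (by fun_prop), integral_prod,
    ← integral_complex_ofReal]
  · refine integral_congr_ae (ae_of_all _ fun r => ?_)
    simp only
    rw [← h, charFun_apply_real]
    refine integral_congr_ae (ae_of_all _ fun x => ?_)
    simp only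
    push_cast
    ring_nf
  · refine Integrable.of_bound (by fun_prop) 1 (ae_of_all _ fun p => ?_)
    rw [← Complex.ofReal_mul, Complex.norm_exp_ofReal_mul_I]

end IsCharFun

lemma charFun_expMeasure_one (t : ℝ) : charFun (expMeasure 1) t = (1 - t * Complex.I)⁻¹ := by
  have hre : ((t : ℂ) * Complex.I - 1).re < 0 := by simp
  rw [charFun_apply_real, expMeasure, gammaMeasure,
    integral_withDensity_eq_integral_toReal_smul (f := gammaPDF 1 1)
      (measurable_gammaPDFReal 1 1).ennreal_ofReal (ae_of_all _ fun x => ENNReal.ofReal_lt_top)]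
  have h : (fun x : ℝ => (gammaPDF 1 1 x).toReal • Complex.exp (t * x * Complex.I)) =
      (Ici 0).indicator fun x : ℝ => Complex.exp ((t * Complex.I - 1) * x) := by
    ext x
    have hx : gammaPDF 1 1 x = exponentialPDF 1 x := rfl
    rw [hx, exponentialPDF_eq]
    by_cases h0 : 0 ≤ x
    · simp only [h0, if_true, one_mul, mem_Ici, indicator_of_mem]
      rw [ENNReal.toReal_ofReal (Real.exp_pos _).le, Complex.real_smul, Complex.ofReal_exp,
        ← Complex.exp_add]
      push_cast
      ring_nf
    · simp [h0]
  rw [h, integral_indicator measurableSet_Ici, integral_Ici_eq_integral_Ioi,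
    integral_exp_mul_complex_Ioi hre]
  simp only [Complex.ofReal_zero, mul_zero, Complex.exp_zero]
  rw [← neg_sub, neg_div_neg_eq, one_div]

/-- The characteristic function of the density `|x| exp (-|x|) / 2`. -/
lemma isCharFun_symm_gamma_two : IsCharFun fun u => (1 - u ^ 2) / (1 + u ^ 2) ^ 2 := by
  have := isProbabilityMeasure_expMeasure one_pos
  convert IsCharFun.re ((expMeasure 1).conv (expMeasure 1)) using 2 with u
  rw [charFun_conv, charFun_expMeasure_one]
  have h : 1 + u ^ 2 ≠ 0 := by positivity
  have h' : 1 + u * u ≠ 0 := by rwa [← sq]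
  simp [Complex.mul_re, Complex.inv_re, Complex.inv_im, Complex.normSq_apply]
  field_simp

/-- The characteristic function of the selfdecomposable law with Lévy density
`(1 + |x|) exp (-|x|) / (2 |x|)`. -/
noncomputable def wenocurFactor (u : ℝ) : ℝ :=
  (1 + u ^ 2) ^ (-(1 / 2 : ℝ)) * Real.exp (-(u ^ 2 / (1 + u ^ 2)))

lemma wenocurFactor_eq_exp (u : ℝ) :
    wenocurFactor u = Real.exp (-(1 / 2) * Real.log (1 + u ^ 2) - u ^ 2 / (1 + u ^ 2)) := by
  rw [wenocurFactor, Real.rpow_def_of_pos (by positivity), ← Real.exp_add]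
  ring_nf

lemma wenocurFactor_pos (u : ℝ) : 0 < wenocurFactor u := by
  rw [wenocurFactor_eq_exp]
  exact Real.exp_pos _

lemma hasDerivAt_log_wenocurFactor (L t r : ℝ) :
    HasDerivAt (fun r => -(1 / 2) * Real.log (1 + (Real.exp (-L * r) * t) ^ 2) -
        (Real.exp (-L * r) * t) ^ 2 / (1 + (Real.exp (-L * r) * t) ^ 2))
      (-L * ((1 - (Real.exp (-L * r) * t) ^ 2) / (1 + (Real.exp (-L * r) * t) ^ 2) ^ 2 - 1)) r := by
  have hs : HasDerivAt (fun r => (Real.exp (-L * r) * t) ^ 2)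
      (-2 * L * (Real.exp (-L * r) * t) ^ 2) r := by
    have h := ((((hasDerivAt_id r).const_mul (-L)).exp).mul_const t).pow 2
    convert! h using 1
    simp
    ring
  have hpos : 0 < 1 + (Real.exp (-L * r) * t) ^ 2 := by positivity
  have h1 := hs.const_add 1
  convert! ((h1.log hpos.ne').const_mul (-(1 / 2))).sub (hs.div h1 hpos.ne') using 1
  field_simp
  ring

lemma isCharFun_wenocurFactor_div {c : ℝ} (hc : c ∈ Ioo (0 : ℝ) 1) :
    IsCharFun fun t => wenocurFactor t / wenocurFactor (c * t) := by
  have hL : 0 < -Real.log c := neg_pos.2 (Real.log_neg hc.1 hc.2)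
  have hP : IsProbabilityMeasure (volume.restrict (Ioc (0 : ℝ) 1)) := ⟨by simp⟩
  have h := (isCharFun_symm_gamma_two.scale_mixture (volume.restrict (Ioc (0 : ℝ) 1))
    (s := fun r => Real.exp (-(-Real.log c) * r)) (by fun_prop)).exp_sub_one hL.le
  convert h using 2 with t
  have hcont : Continuous fun r : ℝ => (1 - (Real.exp (-(-Real.log c) * r) * t) ^ 2) /
      (1 + (Real.exp (-(-Real.log c) * r) * t) ^ 2) ^ 2 :=
    Continuous.div (by fun_prop) (by fun_prop) fun r => by positivity
  have hftc := intervalIntegral.integral_eq_sub_of_hasDerivAt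
    (fun r _ => hasDerivAt_log_wenocurFactor (-Real.log c) t r)
    (((hcont.sub continuous_const).const_mul _).intervalIntegrable 0 1)
  rw [intervalIntegral.integral_const_mul, intervalIntegral.integral_sub
    (hcont.intervalIntegrable 0 1) (by simp), intervalIntegral.integral_of_le zero_le_one] at hftc
  rw [wenocurFactor_eq_exp, wenocurFactor_eq_exp, ← Real.exp_sub]
  congr 1
  simp only [mul_one, neg_neg, Real.exp_log hc.1, mul_zero, Real.exp_zero, one_mul,
    intervalIntegral.integral_const, sub_zero, smul_eq_mul] at hftc ⊢
  linarith

lemma div_pi_mul_I_mem_integerComplement {t : ℝ} (ht : t ≠ 0) :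
    ((t / Real.pi : ℝ) : ℂ) * Complex.I ∈ Complex.integerComplement := by
  rintro ⟨n, hn⟩
  have h := congrArg Complex.im hn
  have h' : 0 = t / Real.pi := by simpa using h
  exact div_ne_zero ht Real.pi_ne_zero h'.symm

lemma pi_mul_div_pi_mul_I (t : ℝ) :
    (Real.pi : ℂ) * (((t / Real.pi : ℝ) : ℂ) * Complex.I) = t * Complex.I := by
  have := Real.pi_ne_zero
  rw [← mul_assoc, ← Complex.ofReal_mul, mul_div_cancel₀ _ this]

lemma tendsto_prod_sinh {t : ℝ} (ht : t ≠ 0) :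
    Tendsto (fun n : ℕ => ∏ i ∈ Finset.range n, (1 + t ^ 2 / (Real.pi * (i + 1)) ^ 2)) atTop
      (𝓝 (Real.sinh t / t)) := by
  have h := tendsto_euler_sin_prod'
    (Complex.integerComplement.ne_zero (div_pi_mul_I_mem_integerComplement ht))
  rw [pi_mul_div_pi_mul_I, Complex.sin_mul_I, mul_div_mul_right _ _ Complex.I_ne_zero,
    ← Complex.ofReal_sinh, ← Complex.ofReal_div] at h
  have h2 := (Complex.continuous_re.tendsto _).comp h
  rw [Complex.ofReal_re] at h2
  refine h2.congr fun n => ?_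
  rw [Function.comp_apply, ← Complex.ofReal_re (∏ i ∈ _, _)]
  congr 1
  push_cast
  refine Finset.prod_congr rfl fun i _ => ?_
  rw [sineTerm, mul_pow _ Complex.I, Complex.I_sq, mul_pow, div_pow]
  simp [div_div]

lemma tendsto_sum_coth {t : ℝ} (ht : t ≠ 0) :
    Tendsto (fun n : ℕ => ∑ i ∈ Finset.range n, 2 * t ^ 2 / ((Real.pi * (i + 1)) ^ 2 + t ^ 2))
      atTop (𝓝 (t * (Real.cosh t / Real.sinh t) - 1)) := by
  have hx := div_pi_mul_I_mem_integerComplement ht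
  have h := (tendsto_logDeriv_euler_cot_sub hx).const_mul (((t / Real.pi : ℝ) : ℂ) * Complex.I)
  have hpi : (Real.pi : ℂ) ≠ 0 := by simp [Real.pi_ne_zero]
  have ht' : (t : ℂ) ≠ 0 := by simpa
  have hsinh : (Complex.sinh t) ≠ 0 := by
    rw [← Complex.ofReal_sinh, Complex.ofReal_ne_zero]
    simpa using ht
  have hlim : ((t / Real.pi : ℝ) : ℂ) * Complex.I *
      (Real.pi * Complex.cot (Real.pi * (((t / Real.pi : ℝ) : ℂ) * Complex.I)) -
        1 / (((t / Real.pi : ℝ) : ℂ) * Complex.I)) =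
      ((t * (Real.cosh t / Real.sinh t) - 1 : ℝ) : ℂ) := by
    rw [pi_mul_div_pi_mul_I, Complex.cot, Complex.sin_mul_I, Complex.cos_mul_I]
    have hI := Complex.I_ne_zero
    push_cast
    field_simp
  rw [hlim] at h
  have h2 := (Complex.continuous_re.tendsto _).comp h
  rw [Complex.ofReal_re] at h2
  refine h2.congr fun n => ?_
  rw [Function.comp_apply, ← Complex.ofReal_re (∑ i ∈ _, _), Finset.mul_sum]
  congr 1
  rw [Complex.ofReal_sum]
  refine Finset.sum_congr rfl fun i _ => ?_
  rw [cotTerm_identity hx]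
  have hpos : ((Real.pi * (i + 1)) ^ 2 + t ^ 2 : ℂ) ≠ 0 := by
    have : (Real.pi * (i + 1)) ^ 2 + t ^ 2 ≠ 0 := by positivity
    exact_mod_cast this
  have hden : (((t / Real.pi : ℝ) : ℂ) * Complex.I + (i + 1)) *
      (((t / Real.pi : ℝ) : ℂ) * Complex.I - (i + 1)) =
      -(((Real.pi * (i + 1)) ^ 2 + t ^ 2) / Real.pi ^ 2) := by
    push_cast
    field_simp
    ring_nf
    rw [Complex.I_sq]
    ring
  rw [hden]
  push_cast
  field_simp
  rw [Complex.I_sq]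
  ring

lemma prod_range_two_mul_succ {M : Type*} [CommMonoid M] (F : ℕ → M) (n : ℕ) :
    ∏ i ∈ Finset.range (2 * n), F (i + 1) =
      (∏ i ∈ Finset.range n, F (2 * (i + 1))) * ∏ i ∈ Finset.range n, F (2 * i + 1) := by
  induction n with
  | zero => simp
  | succ n ih =>
    rw [show 2 * (n + 1) = 2 * n + 1 + 1 by ring, Finset.prod_range_succ, Finset.prod_range_succ,
      ih, Finset.prod_range_succ, Finset.prod_range_succ, mul_mul_mul_comm,
      show 2 * (n + 1) = 2 * n + 1 + 1 by ring, mul_assoc (_ * _), mul_comm (F (2 * n + 1))]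

lemma sum_range_two_mul_succ {M : Type*} [AddCommMonoid M] (F : ℕ → M) (n : ℕ) :
    ∑ i ∈ Finset.range (2 * n), F (i + 1) =
      ∑ i ∈ Finset.range n, F (2 * (i + 1)) + ∑ i ∈ Finset.range n, F (2 * i + 1) :=
  prod_range_two_mul_succ (M := Multiplicative M) F n

/-- The reciprocals of the positive zeros of `cos`. -/
noncomputable def cosZeroInv (k : ℕ) : ℝ := 2 / (Real.pi * (2 * k + 1))

lemma tendsto_prod_cosh (t : ℝ) :
    Tendsto (fun n : ℕ => ∏ i ∈ Finset.range n, (1 + (cosZeroInv i * t) ^ 2)) atTop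
      (𝓝 (Real.cosh t)) := by
  rcases eq_or_ne t 0 with rfl | ht
  · simp
  have hs : Real.sinh t ≠ 0 := by simpa using ht
  have h := ((tendsto_prod_sinh (mul_ne_zero two_ne_zero ht)).comp
    (tendsto_id.const_mul_atTop' (two_pos : 0 < 2))).div (tendsto_prod_sinh ht)
      (div_ne_zero hs ht)
  have hlim : Real.sinh (2 * t) / (2 * t) / (Real.sinh t / t) = Real.cosh t := by
    rw [Real.sinh_two_mul]
    field_simp
  rw [hlim] at h
  refine h.congr fun n => ?_
  have h2 := prod_range_two_mul_succ (fun m : ℕ => 1 + (2 * t) ^ 2 / (Real.pi * m) ^ 2) n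
  push_cast at h2
  have h3 : ∏ i ∈ Finset.range n, (1 + t ^ 2 / (Real.pi * (i + 1)) ^ 2) ≠ 0 :=
    Finset.prod_ne_zero_iff.2 fun i _ => by positivity
  have h4 (i : ℕ) : (2 * t) ^ 2 / (Real.pi * (2 * (i + 1))) ^ 2 =
      t ^ 2 / (Real.pi * (i + 1)) ^ 2 := by
    field_simp
  simp only [h4] at h2
  simp only [Pi.div_apply, Function.comp_apply]
  rw [id, h2, mul_div_cancel_left₀ _ h3]
  refine Finset.prod_congr rfl fun i _ => ?_
  rw [cosZeroInv, div_mul_eq_mul_div, div_pow]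

lemma tendsto_sum_tanh (t : ℝ) :
    Tendsto (fun n : ℕ => ∑ i ∈ Finset.range n,
      (cosZeroInv i * t) ^ 2 / (1 + (cosZeroInv i * t) ^ 2)) atTop
      (𝓝 (1 / 2 * t * Real.tanh t)) := by
  rcases eq_or_ne t 0 with rfl | ht
  · simp
  have hs : Real.sinh t ≠ 0 := by simpa using ht
  have hc : Real.cosh t ≠ 0 := (Real.cosh_pos t).ne'
  have h := ((((tendsto_sum_coth (mul_ne_zero two_ne_zero ht)).comp
    (tendsto_id.const_mul_atTop' (two_pos : 0 < 2))).sub (tendsto_sum_coth ht))).const_mul (1 / 2)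
  have hlim : 1 / 2 * (2 * t * (Real.cosh (2 * t) / Real.sinh (2 * t)) - 1 -
      (t * (Real.cosh t / Real.sinh t) - 1)) = 1 / 2 * t * Real.tanh t := by
    rw [Real.sinh_two_mul, Real.cosh_two_mul, Real.tanh_eq_sinh_div_cosh]
    field_simp
    ring
  rw [hlim] at h
  refine h.congr fun n => ?_
  simp only [Function.comp_apply, id]
  have h2 := sum_range_two_mul_succ
    (fun m : ℕ => 2 * (2 * t) ^ 2 / ((Real.pi * m) ^ 2 + (2 * t) ^ 2)) n
  push_cast at h2
  have h4 (i : ℕ) : 2 * (2 * t) ^ 2 / ((Real.pi * (2 * (i + 1))) ^ 2 + (2 * t) ^ 2) =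
      2 * t ^ 2 / ((Real.pi * (i + 1)) ^ 2 + t ^ 2) := by
    rw [div_eq_div_iff (by positivity) (by positivity)]
    ring
  simp only [h4] at h2
  rw [h2, add_sub_cancel_left, Finset.mul_sum]
  refine Finset.sum_congr rfl fun i _ => ?_
  rw [cosZeroInv]
  field_simp

/-- The characteristic function of Wenocur's example. -/
noncomputable def wenocurCharFun (t : ℝ) : ℝ :=
  Real.cosh t ^ (-(1 / 2 : ℝ)) * Real.exp (-(1 / 2 * t * Real.tanh t))

lemma wenocurCharFun_pos (t : ℝ) : 0 < wenocurCharFun t :=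
  mul_pos (Real.rpow_pos_of_pos (Real.cosh_pos t) _) (Real.exp_pos _)

lemma continuous_wenocurCharFun : Continuous wenocurCharFun := by
  have h : Continuous Real.tanh := by
    simp_rw [funext Real.tanh_eq_sinh_div_cosh]
    exact Real.continuous_sinh.div Real.continuous_cosh fun t => (Real.cosh_pos t).ne'
  exact (Real.continuous_cosh.rpow_const fun t => Or.inl (Real.cosh_pos t).ne').mul (by fun_prop)

lemma tendsto_prod_wenocurFactor (t : ℝ) :
    Tendsto (fun n : ℕ => ∏ i ∈ Finset.range n, wenocurFactor (cosZeroInv i * t)) atTop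
      (𝓝 (wenocurCharFun t)) := by
  have h1 := (tendsto_prod_cosh t).rpow_const (p := -(1 / 2 : ℝ)) (Or.inl (Real.cosh_pos t).ne')
  have h2 := (Real.continuous_exp.tendsto _).comp (tendsto_sum_tanh t).neg
  refine (h1.mul h2).congr fun n => ?_
  simp only [wenocurFactor, Function.comp_apply]
  rw [Finset.prod_mul_distrib, ← Real.exp_sum, Finset.sum_neg_distrib,
    Real.finsetProd_rpow _ _ fun i _ => by positivity]

lemma isCharFun_wenocurCharFun_div {c : ℝ} (hc : c ∈ Ioo (0 : ℝ) 1) :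
    IsCharFun fun t => wenocurCharFun t / wenocurCharFun (c * t) := by
  refine IsCharFun.of_tendsto (F := fun n t => ∏ i ∈ Finset.range n,
    (wenocurFactor (cosZeroInv i * t) / wenocurFactor (c * (cosZeroInv i * t))))
    (Eventually.of_forall fun n => IsCharFun.prod _ fun i =>
      (isCharFun_wenocurFactor_div hc).comp_mul_left (cosZeroInv i)) ?_ fun t => ?_
  · exact (continuous_wenocurCharFun.div
      (continuous_wenocurCharFun.comp (continuous_const_mul c))
      fun t => (wenocurCharFun_pos _).ne').continuousAt
  · have h := (tendsto_prod_wenocurFactor t).div (tendsto_prod_wenocurFactor (c * t))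
      (wenocurCharFun_pos _).ne'
    refine h.congr fun n => ?_
    simp only [Pi.div_apply, Finset.prod_div_distrib, mul_left_comm c]

lemma isCharFun_wenocurCharFun : IsCharFun wenocurCharFun := by
  refine IsCharFun.of_tendsto
    (F := fun n t => wenocurCharFun t / wenocurCharFun (1 / ((n + 1 : ℕ) + 1 : ℝ) * t))
    (Eventually.of_forall fun n => isCharFun_wenocurCharFun_div ⟨by positivity, ?_⟩)
    continuous_wenocurCharFun.continuousAt fun t => ?_
  · rw [div_lt_one (by positivity)]
    push_cast
    linarith [(Nat.cast_nonneg n : (0 : ℝ) ≤ n)]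
  · have h0 : wenocurCharFun 0 = 1 := by simp [wenocurCharFun]
    have h : Tendsto (fun n : ℕ => 1 / ((n + 1 : ℕ) + 1 : ℝ) * t) atTop (𝓝 0) := by
      simpa using ((tendsto_add_atTop_iff_nat 1).2
        (tendsto_one_div_add_atTop_nhds_zero_nat (𝕜 := ℝ))).mul_const t
    have h2 := (continuous_wenocurCharFun.tendsto 0).comp h
    rw [h0] at h2
    have h3 := (tendsto_const_nhds (x := wenocurCharFun t)).div h2 one_ne_zero
    rw [div_one] at h3
    exact h3

lemma selfDecomposable_of_charFun {μ : Measure ℝ} [IsProbabilityMeasure μ] {f : ℝ → ℝ}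
    (hμ : ∀ t, charFun μ t = f t) (h0 : ∀ t, f t ≠ 0)
    (hf : ∀ c ∈ Ioo (0 : ℝ) 1, IsCharFun fun t => f t / f (c * t)) : SelfDecomposable μ := by
  intro c hc
  obtain ⟨ν, hν, h⟩ := hf c hc
  have := Measure.isProbabilityMeasure_map (μ := μ) (f := fun x => c * x) (by fun_prop)
  refine ⟨ν, hν, Measure.ext_of_charFun (funext fun t => ?_)⟩
  rw [charFun_conv, charFun_map_mul, h, hμ, hμ, ← Complex.ofReal_mul, mul_div_cancel₀ _ (h0 _)]

/-- Example B.2 (Wenocur integrals): there exists a selfdecomposable probability measure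
on `ℝ` with characteristic function `t ↦ (cosh t)^{-1/2} exp(-(1/2) t tanh t)`. -/
theorem stmt_18 :
    ∃ μ : Measure ℝ, IsProbabilityMeasure μ ∧ SelfDecomposable μ ∧
      ∀ t : ℝ,
        (∫ x, Complex.exp (t * x * Complex.I) ∂μ)
          = (((Real.cosh t) ^ (-(1 / 2 : ℝ)) : ℝ) : ℂ) *
              Complex.exp (-((1 / 2 * t * Real.tanh t : ℝ) : ℂ)) := by
  obtain ⟨μ, hμ, h⟩ := isCharFun_wenocurCharFun
  refine ⟨μ, hμ, selfDecomposable_of_charFun h (fun t => (wenocurCharFun_pos t).ne')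
    fun c hc => isCharFun_wenocurCharFun_div hc, fun t => ?_⟩
  rw [← charFun_apply_real, h, wenocurCharFun, Complex.ofReal_mul, Complex.ofReal_exp,
    Complex.ofReal_neg]
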